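/- Let n and r be positive integers with 2r < n and let s : ℤ/nℤ → {0,1} be any binary string of length n. Then ∑_{i=0}^{n−1} ∑_{j=−r}^{r} (s_i XOR s_{i+j}), where indices are taken modulo n, is at most ((5r/4) + 152)·n. -/

import Mathlib

open Real in
/-- The Dirichlet kernel in closed form, cleared of its denominator. -/
lemma sum_cos_mul_sin (r : ℕ) (φ : ℝ) :
    (∑ j ∈ Finset.Icc (-(r : ℤ)) (r : ℤ), cos (2 * j * φ)) * sin φ = sin ((2 * r + 1) * φ) := by
  induction r with
  | zero => simp
  | succ r ih =>
    have hunion : ∑ j ∈ Finset.Icc (-((r + 1 : ℕ) : ℤ)) ((r + 1 : ℕ) : ℤ), cos (2 * j * φ)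
        = ∑ j ∈ Finset.Icc (-(r : ℤ)) (r : ℤ), cos (2 * j * φ)
          + 2 * cos (2 * (r + 1) * φ) := by
      rw [Nat.cast_add, Nat.cast_one, Finset.Icc_succ_succ, Finset.sum_union (by simp),
        Finset.sum_pair (by lia)]
      push_cast
      rw [show 2 * (-((r : ℝ) + 1)) * φ = -(2 * (r + 1) * φ) by ring, cos_neg]
      ring
    rw [hunion, add_mul, ih]
    push_cast
    have h₁ : (2 * (r : ℝ) + 1) * φ = 2 * (r + 1) * φ - φ := by ring
    have h₂ : (2 * ((r : ℝ) + 1) + 1) * φ = 2 * (r + 1) * φ + φ := by ring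
    rw [h₁, h₂, sin_sub, sin_add]
    ring

open Real in
lemma neg_div_four_le_sin {t : ℝ} (ht : 0 ≤ t) : -(t / 4) ≤ sin t := by
  have hπ := pi_gt_three
  rcases le_or_gt t π with h | h
  · linarith [sin_nonneg_of_nonneg_of_le_pi ht h]
  rcases le_or_gt 4 t with h' | h'
  · linarith [neg_one_le_sin t]
  · have := sin_le (sub_nonneg.2 h.le)
    rw [sin_sub_pi] at this
    linarith

open Real in
lemma neg_mul_sin_le_sin_mul (r : ℕ) {φ : ℝ} (h₀ : 0 < φ) (h₁ : φ ≤ π / 2) :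
    -((r / 2 + 303 : ℝ) * sin φ) ≤ sin ((2 * r + 1) * φ) := by
  have hπ := pi_gt_three
  have hπ' := pi_lt_d2
  have hr : (0 : ℝ) ≤ r := r.cast_nonneg
  have hjordan : 0.6 * φ ≤ sin φ := by
    refine le_trans ?_ (mul_le_sin h₀.le h₁)
    gcongr
    rw [le_div_iff₀ pi_pos]
    linarith
  set t := (2 * (r : ℝ) + 1) * φ with ht
  rcases le_or_gt 8 t with h8 | h8
  · refine le_trans ?_ (neg_one_le_sin t)
    nlinarith
  rcases le_or_gt 1 φ with hφ | hφ
  · refine le_trans ?_ (neg_one_le_sin t)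
    nlinarith
  · refine le_trans ?_ (neg_div_four_le_sin (by positivity))
    have hcube := sin_gt_sub_cube h₀
    have h₂ : (r / 2 + 1 / 4 : ℝ) * (φ - φ ^ 3 / 6) ≤ (r / 2 + 1 / 4) * sin φ := by
      gcongr
    have h₃ : (r / 2 + 1 / 4 : ℝ) * (φ - φ ^ 3 / 6) = t / 4 - t * φ ^ 2 / 24 := by
      rw [ht]; ring
    have h₄ : t * φ ^ 2 ≤ 8 * φ := by nlinarith
    linarith

open Real in
/-- A lower bound on the Dirichlet kernel. -/
lemma neg_le_sum_cos (r : ℕ) {φ : ℝ} (h₀ : 0 ≤ φ) (h₁ : φ < π) :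
    -(r / 2 + 303 : ℝ) ≤ ∑ j ∈ Finset.Icc (-(r : ℤ)) (r : ℤ), cos (2 * j * φ) := by
  have key : ∀ φ : ℝ, 0 < φ → φ ≤ π / 2 →
      -(r / 2 + 303 : ℝ) ≤ ∑ j ∈ Finset.Icc (-(r : ℤ)) (r : ℤ), cos (2 * j * φ) := by
    intro φ h₀ h₁
    refine le_of_mul_le_mul_right ?_ (sin_pos_of_pos_of_lt_pi h₀ (by linarith [pi_pos]))
    rw [sum_cos_mul_sin, neg_mul]
    exact neg_mul_sin_le_sin_mul r h₀ h₁
  rcases h₀.eq_or_lt with rfl | h₀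
  · refine le_trans (b := 0) (by rw [neg_nonpos]; positivity) (Finset.sum_nonneg fun j _ => ?_)
    simp
  rcases le_or_gt φ (π / 2) with h | h
  · exact key φ h₀ h
  · refine (key (π - φ) (by linarith) (by linarith)).trans_eq (Finset.sum_congr rfl fun j _ => ?_)
    rw [show 2 * (j : ℝ) * (π - φ) = j * (2 * π) - 2 * j * φ by ring, cos_int_mul_two_pi_sub]

lemma sum_stdAddChar_Icc {n : ℕ} [NeZero n] (r : ℕ) (k : ZMod n) :
    ∑ j ∈ Finset.Icc (-(r : ℤ)) (r : ℤ), ZMod.stdAddChar (k * (j : ZMod n))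
      = ((∑ j ∈ Finset.Icc (-(r : ℤ)) (r : ℤ),
          Real.cos (2 * j * (Real.pi * k.val / n)) : ℝ) : ℂ) := by
  have hterm : ∀ j : ℤ, ZMod.stdAddChar (k * (j : ZMod n))
      = ((Real.cos (2 * j * (Real.pi * k.val / n)) : ℝ) : ℂ)
        + ((Real.sin (2 * j * (Real.pi * k.val / n)) : ℝ) : ℂ) * Complex.I := by
    intro j
    have hcast : k * (j : ZMod n) = (((k.val : ℤ) * j : ℤ) : ZMod n) := by simp
    rw [hcast, ZMod.stdAddChar_coe, Complex.ofReal_cos, Complex.ofReal_sin,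
      ← Complex.exp_mul_I]
    congr 1
    push_cast
    ring
  have hodd : ∑ j ∈ Finset.Icc (-(r : ℤ)) (r : ℤ),
      Real.sin (2 * j * (Real.pi * k.val / n)) = 0 := by
    have h : ∑ j ∈ Finset.Icc (-(r : ℤ)) (r : ℤ), Real.sin (2 * j * (Real.pi * k.val / n))
        = ∑ j ∈ Finset.Icc (-(r : ℤ)) (r : ℤ), -Real.sin (2 * j * (Real.pi * k.val / n)) := by
      refine Finset.sum_nbij' (fun j => -j) (fun j => -j) ?_ ?_ ?_ ?_ ?_
      · intro j hj; simp only [Finset.mem_Icc] at hj ⊢; lia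
      · intro j hj; simp only [Finset.mem_Icc] at hj ⊢; lia
      · intro j _; simp
      · intro j _; simp
      · intro j _
        rw [← Real.sin_neg]
        congr 1
        push_cast
        ring
    rw [Finset.sum_neg_distrib] at h
    linarith
  simp_rw [hterm]
  rw [Finset.sum_add_distrib, ← Finset.sum_mul, ← Complex.ofReal_sum, ← Complex.ofReal_sum, hodd]
  simp

/-- The finite Wiener–Khinchin identity. -/
lemma card_mul_autocorrelation {n : ℕ} [NeZero n] (x : ZMod n → ℝ) (a : ZMod n) :
    (n : ℂ) * ((∑ i, x i * x (i + a) : ℝ) : ℂ)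
      = ∑ k : ZMod n, ((Complex.normSq (∑ i, (x i : ℂ) * ZMod.stdAddChar (k * i)) : ℝ) : ℂ)
          * ZMod.stdAddChar (k * a) := by
  have hexp : ∀ k : ZMod n,
      ((Complex.normSq (∑ i, (x i : ℂ) * ZMod.stdAddChar (k * i)) : ℝ) : ℂ)
          * ZMod.stdAddChar (k * a)
        = ∑ i, ∑ i', (x i : ℂ) * x i' * ZMod.stdAddChar (k * (i + a - i')) := by
    intro k
    rw [← Complex.mul_conj, map_sum, Finset.sum_mul_sum, Finset.sum_mul]
    refine Finset.sum_congr rfl fun i _ => ?_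
    rw [Finset.sum_mul]
    refine Finset.sum_congr rfl fun i' _ => ?_
    rw [map_mul (starRingEnd ℂ), Complex.conj_ofReal, ← AddChar.map_neg_eq_conj,
      show k * (i + a - i') = k * i + -(k * i') + k * a by ring,
      AddChar.map_add_eq_mul, AddChar.map_add_eq_mul]
    ring
  simp_rw [hexp]
  rw [Finset.sum_comm, Complex.ofReal_sum, Finset.mul_sum]
  refine Finset.sum_congr rfl fun i _ => ?_
  rw [Finset.sum_comm]
  simp_rw [← Finset.mul_sum, AddChar.sum_mulShift _ (ZMod.isPrimitive_stdAddChar n), sub_eq_zero]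
  simp [ZMod.card]
  ring

lemma neg_mul_sum_sq_le_autocorrelation {n : ℕ} [NeZero n] (r : ℕ) (x : ZMod n → ℝ) :
    -(r / 2 + 303 : ℝ) * ∑ i, x i * x i
      ≤ ∑ i, ∑ j ∈ Finset.Icc (-(r : ℤ)) (r : ℤ), x i * x (i + (j : ZMod n)) := by
  set P : ZMod n → ℝ := fun k => Complex.normSq (∑ i, (x i : ℂ) * ZMod.stdAddChar (k * i))
  set D : ZMod n → ℝ := fun k => ∑ j ∈ Finset.Icc (-(r : ℤ)) (r : ℤ),
    Real.cos (2 * j * (Real.pi * k.val / n))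
  have hn : (0 : ℝ) < n := Nat.cast_pos.2 (NeZero.pos n)
  have hnorm : (n : ℝ) * ∑ i, x i * x i = ∑ k, P k := by
    have h := card_mul_autocorrelation x 0
    simp only [mul_zero, AddChar.map_zero_eq_one, mul_one, add_zero] at h
    exact_mod_cast h
  have hcorr : (n : ℝ) * ∑ i, ∑ j ∈ Finset.Icc (-(r : ℤ)) (r : ℤ), x i * x (i + (j : ZMod n))
      = ∑ k, P k * D k := by
    rw [Finset.sum_comm, ← Complex.ofReal_inj, Complex.ofReal_mul, Complex.ofReal_sum,
      Complex.ofReal_natCast, Finset.mul_sum]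
    simp_rw [card_mul_autocorrelation]
    rw [Finset.sum_comm, Complex.ofReal_sum]
    refine Finset.sum_congr rfl fun k _ => ?_
    rw [← Finset.mul_sum, sum_stdAddChar_Icc, Complex.ofReal_mul]
  have hD : ∀ k, -(r / 2 + 303 : ℝ) ≤ D k := by
    intro k
    refine neg_le_sum_cos r (by positivity) ?_
    rw [div_lt_iff₀ hn]
    gcongr
    exact ZMod.val_lt k
  refine le_of_mul_le_mul_left ?_ hn
  rw [hcorr, mul_left_comm, hnorm, Finset.mul_sum]
  refine Finset.sum_le_sum fun k _ => ?_
  rw [mul_comm]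
  exact mul_le_mul_of_nonneg_left (hD k) (Complex.normSq_nonneg _)

lemma sum_range_natCast_zmod {M : Type*} [AddCommMonoid M] {n : ℕ} [NeZero n] (f : ZMod n → M) :
    ∑ i ∈ Finset.range n, f (i : ZMod n) = ∑ i, f i := by
  refine Finset.sum_nbij' (fun i => (i : ZMod n)) ZMod.val ?_ ?_ ?_ ?_ ?_
  · simp
  · intro i _; simpa using ZMod.val_lt i
  · intro i hi; exact ZMod.val_cast_of_lt (Finset.mem_range.1 hi)
  · simp
  · simp

/-- for any binary string `s` of length `n` (indexed by `ℤ/nℤ`)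
and `2r < n`, the sum `∑_{i=0}^{n−1} ∑_{j=−r}^{r} (s_i XOR s_{i+j})` (indices
mod n) is at most `((5r/4) + 152)·n`. -/
theorem stmt10 (n r : ℕ) (hn : 0 < n) (hr : 0 < r) (hrn : 2 * r < n)
    (s : ZMod n → Bool) :
    ((∑ i ∈ Finset.range n, ∑ j ∈ Finset.Icc (-(r : ℤ)) (r : ℤ),
        (if s ((i : ZMod n)) ≠ s ((i : ZMod n) + (j : ZMod n)) then 1 else 0) : ℕ) : ℝ)
      ≤ (5 * r / 4 + 152) * n := by
  have : NeZero n := ⟨hn.ne'⟩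
  rw [sum_range_natCast_zmod (fun i => ∑ j ∈ Finset.Icc (-(r : ℤ)) (r : ℤ),
    (if s i ≠ s (i + (j : ZMod n)) then 1 else 0))]
  set x : ZMod n → ℝ := fun i => if s i then 1 else -1 with hx
  have hxor : ∀ a b : ZMod n, (((if s a ≠ s b then 1 else 0 : ℕ)) : ℝ) = (1 - x a * x b) / 2 := by
    intro a b
    simp only [hx]
    cases s a <;> cases s b <;> norm_num
  have hsq : ∑ i, x i * x i = n := by
    have h : ∀ i, x i * x i = 1 := by
      intro i
      simp only [hx]
      split_ifs <;> norm_num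
    simp [h, ZMod.card]
  have hquad := neg_mul_sum_sq_le_autocorrelation r x
  rw [hsq] at hquad
  simp only [Nat.cast_sum, hxor]
  simp_rw [← Finset.sum_div, Finset.sum_sub_distrib]
  simp only [Finset.sum_const, Int.card_Icc, Finset.card_univ, ZMod.card, nsmul_eq_mul, mul_one]
  have hcard : (((r : ℤ) + 1 - -(r : ℤ)).toNat : ℝ) = 2 * r + 1 := by
    rw [show ((r : ℤ) + 1 - -(r : ℤ)).toNat = 2 * r + 1 by lia]
    push_cast
    ring
  rw [hcard]
  linarith
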